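/- arXiv:math/0304302 — 2 statements merged into one kernel-verified Lean document; each statement's English description precedes it below -/
import Mathlib

section
/- For all nonnegative integers b_0, b_1, b_2, b_3, b_4, the following identity of formal power series in t with coefficients in ℤ[z] holds (the infinite product converging in the t-adic topology): ∏_{k≥1} (1+z^{2k-1}t^k)^{b_1}(1+z^{2k+1}t^k)^{b_3} · (1-z^{2k-2}t^k)^{-b_0}(1-z^{2k}t^k)^{-b_2}(1-z^{2k+2}t^k)^{-b_4} = ∑_{n≥0} t^n ∑_{α=(1^{a_1},2^{a_2},…,n^{a_n})∈P(n)} z^{2(n-|α|)} ∏_{i=1}^{n} M_{a_i}(z), where M_m(z) denotes the coefficient of s^m in the power series (1+zs)^{b_1}(1+z^3 s)^{b_3}(1-s)^{-b_0}(1-z^2 s)^{-b_2}(1-z^4 s)^{-b_4} ∈ ℤ[z][[s]]. -/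
/- STATEMENT 0: Göttsche's product formula, combinatorial form.

We work in the ring `(ℤ[z])[[t]]` of formal power series in `t` with coefficients in the
polynomial ring `ℤ[z]`.  Since every series `1 - z^j t^k` (with `k ≥ 1`) has constant
term `1`, its inverse is `PowerSeries.invOfUnit _ 1`. -/

/-- the constant power series `z^j ∈ ℤ[z] ⊆ (ℤ[z])[[t]]`. -/
noncomputable def zpow (j : ℕ) : PowerSeries (Polynomial ℤ) :=
  PowerSeries.C (R := Polynomial ℤ) (Polynomial.X ^ j)

/-- The `k`-th factor of Göttsche's infinite product:
`(1+z^{2k-1}t^k)^{b₁} (1+z^{2k+1}t^k)^{b₃}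
  (1-z^{2k-2}t^k)^{-b₀} (1-z^{2k}t^k)^{-b₂} (1-z^{2k+2}t^k)^{-b₄}`. -/
noncomputable def goettscheFactor (b0 b1 b2 b3 b4 k : ℕ) : PowerSeries (Polynomial ℤ) :=
  (1 + zpow (2 * k - 1) * PowerSeries.X ^ k) ^ b1 *
    (1 + zpow (2 * k + 1) * PowerSeries.X ^ k) ^ b3 *
    (PowerSeries.invOfUnit (1 - zpow (2 * k - 2) * PowerSeries.X ^ k) 1) ^ b0 *
    (PowerSeries.invOfUnit (1 - zpow (2 * k) * PowerSeries.X ^ k) 1) ^ b2 *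
    (PowerSeries.invOfUnit (1 - zpow (2 * k + 2) * PowerSeries.X ^ k) 1) ^ b4

/-- Macdonald's polynomial `M_m(z)`: the coefficient of `s^m` in the power series
`(1+zs)^{b₁}(1+z³s)^{b₃}(1-s)^{-b₀}(1-z²s)^{-b₂}(1-z⁴s)^{-b₄} ∈ ℤ[z][[s]]`. -/
noncomputable def macdonaldCoeff (b0 b1 b2 b3 b4 m : ℕ) : Polynomial ℤ :=
  PowerSeries.coeff (R := Polynomial ℤ) m
    ((1 + zpow 1 * PowerSeries.X) ^ b1 *
      (1 + zpow 3 * PowerSeries.X) ^ b3 *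
      (PowerSeries.invOfUnit (1 - PowerSeries.X) 1) ^ b0 *
      (PowerSeries.invOfUnit (1 - zpow 2 * PowerSeries.X) 1) ^ b2 *
      (PowerSeries.invOfUnit (1 - zpow 4 * PowerSeries.X) 1) ^ b4)

/-- The right-hand side:
`∑_{n≥0} t^n ∑_{α=(1^{a₁},…,n^{a_n})∈P(n)} z^{2(n-|α|)} ∏_{i=1}^n M_{a_i}(z)`,
where for a partition `α` of `n`, `a_i = α.parts.count i` is the number of parts equal
to `i` and `|α| = α.parts.card` is the total number of parts. -/
noncomputable def goettscheRHS (b0 b1 b2 b3 b4 : ℕ) : PowerSeries (Polynomial ℤ) :=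
  PowerSeries.mk fun n : ℕ =>
    ∑ α : Nat.Partition n,
      Polynomial.X ^ (2 * (n - α.parts.card)) *
        ∏ i ∈ Finset.Icc 1 n, macdonaldCoeff b0 b1 b2 b3 b4 (α.parts.count i)

open scoped PowerSeries.WithPiTopology in
/-- The generating function of partitions weighted by `∏ i, w i ^ aᵢ * coeff aᵢ G` is the infinite
product of the series `G (w i * X ^ i)`. -/
theorem hasProd_expand_rescale {R : Type*} [CommRing R] [TopologicalSpace R] [T2Space R]
    (w : ℕ → R) (G : PowerSeries R) (hG : PowerSeries.constantCoeff G = 1) :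
    HasProd (fun i ↦ PowerSeries.expand (i + 1) i.succ_ne_zero (PowerSeries.rescale (w (i + 1)) G))
      (Nat.Partition.genFun fun i c ↦ w i ^ c * PowerSeries.coeff c G) := by
  refine (Nat.Partition.hasProd_genFun _).congr_fun fun i ↦ ?_
  ext n
  rw [map_add, (Nat.Partition.summable_genFun_term
      (fun i c ↦ w i ^ c * PowerSeries.coeff c G) i).map_tsum _
    (PowerSeries.WithPiTopology.continuous_coeff _ _), PowerSeries.coeff_expand,
    PowerSeries.coeff_rescale]
  simp only [map_smul, PowerSeries.coeff_X_pow, smul_eq_mul, mul_ite, mul_one,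
    mul_zero, PowerSeries.coeff_one]
  split_ifs with hdvd hn hn
  · subst hn
    simp [hG]
  · obtain ⟨c, rfl⟩ := hdvd
    obtain ⟨c, rfl⟩ := Nat.exists_eq_add_one_of_ne_zero (show c ≠ 0 by rintro rfl; simp at hn)
    rw [tsum_eq_single c, Nat.mul_div_cancel_left _ i.succ_pos]
    · simp
    · intro j hj
      rw [if_neg]
      rw [Nat.mul_right_inj i.succ_ne_zero]
      omega
  · simp [hn] at hdvd
  · have (j : ℕ) : n ≠ (i + 1) * (j + 1) := fun h ↦ hdvd ⟨_, h⟩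
    simp [this]

open scoped PowerSeries.WithPiTopology in
/-- Coefficientwise form of `hasProd_expand_rescale`, without a topology on `R`. -/
theorem coeff_prod_expand_rescale_eventually {R : Type*} [CommRing R]
    (w : ℕ → R) (G : PowerSeries R) (hG : PowerSeries.constantCoeff G = 1) (n : ℕ) :
    ∃ N : ℕ, ∀ M : ℕ, N ≤ M →
      PowerSeries.coeff n (∏ i ∈ Finset.range M,
          PowerSeries.expand (i + 1) i.succ_ne_zero (PowerSeries.rescale (w (i + 1)) G)) =
        PowerSeries.coeff n
          (Nat.Partition.genFun fun i c ↦ w i ^ c * PowerSeries.coeff c G) := by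
  let _ : TopologicalSpace R := ⊥
  have : DiscreteTopology R := ⟨rfl⟩
  have h := (PowerSeries.WithPiTopology.tendsto_iff_coeff_tendsto _ _ _ _).1
    (hasProd_expand_rescale w G hG).tendsto_prod_nat n
  rw [nhds_discrete, Filter.tendsto_pure] at h
  exact Filter.eventually_atTop.1 h

/-- The substitution `X ↦ a * X ^ k` as a ring homomorphism. -/
noncomputable def expandRescale {R : Type*} [CommRing R] (k : ℕ) (hk : k ≠ 0) (a : R) :
    PowerSeries R →+* PowerSeries R :=
  (PowerSeries.expand k hk).toRingHom.comp (PowerSeries.rescale a)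

theorem map_invOfUnit_one {R S : Type*} [CommRing R] [CommRing S]
    (f : PowerSeries R →+* PowerSeries S) (φ : PowerSeries R)
    (hφ : PowerSeries.constantCoeff φ = 1) (hf : PowerSeries.constantCoeff (f φ) = 1) :
    f (PowerSeries.invOfUnit φ 1) = PowerSeries.invOfUnit (f φ) 1 := by
  refine left_inv_eq_right_inv (a := f φ) ?_ (PowerSeries.mul_invOfUnit _ _ (by simpa using hf))
  rw [← map_mul, PowerSeries.invOfUnit_mul _ _ (by simpa using hφ), map_one]

/-- The generating series of the Macdonald polynomials. -/
noncomputable def macdonaldSeries (b0 b1 b2 b3 b4 : ℕ) : PowerSeries (Polynomial ℤ) :=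
  (1 + zpow 1 * PowerSeries.X) ^ b1 *
    (1 + zpow 3 * PowerSeries.X) ^ b3 *
    (PowerSeries.invOfUnit (1 - PowerSeries.X) 1) ^ b0 *
    (PowerSeries.invOfUnit (1 - zpow 2 * PowerSeries.X) 1) ^ b2 *
    (PowerSeries.invOfUnit (1 - zpow 4 * PowerSeries.X) 1) ^ b4

theorem constantCoeff_macdonaldSeries (b0 b1 b2 b3 b4 : ℕ) :
    PowerSeries.constantCoeff (macdonaldSeries b0 b1 b2 b3 b4) = 1 := by
  simp [macdonaldSeries]

theorem expand_rescale_zpow_mul_X {k : ℕ} (hk : k ≠ 0) (i j : ℕ) :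
    PowerSeries.expand k hk (PowerSeries.rescale (Polynomial.X ^ i) (zpow j * PowerSeries.X)) =
      zpow (i + j) * PowerSeries.X ^ k := by
  have hC : PowerSeries.rescale (Polynomial.X ^ i : Polynomial ℤ) (zpow j) = zpow j := by
    ext n : 1
    rw [PowerSeries.coeff_rescale, zpow, PowerSeries.coeff_C]
    split_ifs with h <;> simp [h]
  rw [map_mul, hC, PowerSeries.rescale_X, map_mul, map_mul, PowerSeries.expand_X, zpow,
    PowerSeries.expand_C, PowerSeries.expand_C, ← mul_assoc, ← map_mul, ← pow_add, add_comm, zpow]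

theorem goettscheFactor_eq (b0 b1 b2 b3 b4 : ℕ) {k : ℕ} (hk : k ≠ 0) :
    goettscheFactor b0 b1 b2 b3 b4 k =
      PowerSeries.expand k hk (PowerSeries.rescale (Polynomial.X ^ (2 * k - 2))
        (macdonaldSeries b0 b1 b2 b3 b4)) := by
  let f := expandRescale k hk (Polynomial.X ^ (2 * k - 2) : Polynomial ℤ)
  have hfX (j : ℕ) : f (zpow j * PowerSeries.X) = zpow (2 * k - 2 + j) * PowerSeries.X ^ k :=
    expand_rescale_zpow_mul_X hk _ j
  have hinv (j : ℕ) : f (PowerSeries.invOfUnit (1 - zpow j * PowerSeries.X) 1) =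
      PowerSeries.invOfUnit (1 - zpow (2 * k - 2 + j) * PowerSeries.X ^ k) 1 := by
    rw [map_invOfUnit_one, map_sub, map_one, hfX]
    · simp
    · simp [hfX, hk]
  have h0 : (1 - PowerSeries.X : PowerSeries (Polynomial ℤ)) = 1 - zpow 0 * PowerSeries.X := by
    simp [zpow]
  change _ = f (macdonaldSeries b0 b1 b2 b3 b4)
  rw [macdonaldSeries, h0]
  simp only [map_mul, map_pow, map_add, map_one, hfX, hinv]
  rw [goettscheFactor, show 2 * k - 2 + 1 = 2 * k - 1 by omega,
    show 2 * k - 2 + 3 = 2 * k + 1 by omega, show 2 * k - 2 + 2 = 2 * k by omega,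
    show 2 * k - 2 + 4 = 2 * k + 2 by omega, add_zero]

theorem goettscheRHS_eq_genFun (b0 b1 b2 b3 b4 : ℕ) :
    goettscheRHS b0 b1 b2 b3 b4 = Nat.Partition.genFun fun i c ↦
      (Polynomial.X ^ (2 * i - 2)) ^ c *
        PowerSeries.coeff c (macdonaldSeries b0 b1 b2 b3 b4) := by
  ext1 n
  rw [goettscheRHS, PowerSeries.coeff_mk, Nat.Partition.coeff_genFun]
  refine Finset.sum_congr rfl fun α _ ↦ ?_
  have hsub : α.parts.toFinset ⊆ Finset.Icc 1 n := fun i hi ↦ by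
    rw [Multiset.mem_toFinset] at hi
    exact Finset.mem_Icc.2 ⟨α.parts_pos hi, α.le_of_mem_parts hi⟩
  have hexp : ∑ i ∈ α.parts.toFinset, (2 * i - 2) * α.parts.count i =
      2 * (n - α.parts.card) := by
    have hsum : ∑ i ∈ α.parts.toFinset, α.parts.count i * i = n := by
      simpa using (Finset.sum_multiset_count α.parts).symm.trans α.parts_sum
    have hcard := Multiset.toFinset_sum_count_eq α.parts
    have : ∑ i ∈ α.parts.toFinset, (2 * i - 2) * α.parts.count i +
        2 * ∑ i ∈ α.parts.toFinset, α.parts.count i =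
          2 * ∑ i ∈ α.parts.toFinset, α.parts.count i * i := by
      rw [Finset.mul_sum, Finset.mul_sum, ← Finset.sum_add_distrib]
      refine Finset.sum_congr rfl fun i hi ↦ ?_
      obtain ⟨j, rfl⟩ := Nat.exists_eq_add_one_of_ne_zero
        (α.parts_pos (Multiset.mem_toFinset.1 hi)).ne'
      rw [show 2 * (j + 1) - 2 = 2 * j by omega]
      ring
    omega
  rw [Finsupp.prod, Multiset.toFinsupp_support]
  simp only [Multiset.toFinsupp_apply]
  rw [Finset.prod_mul_distrib, ← hexp, ← Finset.prod_pow_eq_pow_sum]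
  simp only [pow_mul]
  congr 1
  refine (Finset.prod_subset hsub fun i _ hi ↦ ?_).symm
  rw [Multiset.count_eq_zero_of_notMem (by simpa using hi)]
  exact (PowerSeries.coeff_zero_eq_constantCoeff_apply _).trans
    (constantCoeff_macdonaldSeries b0 b1 b2 b3 b4)

/-- Göttsche's identity
`∏_{k≥1}∏_{i=0}^4 (1-z^{2k-2+i}t^k)^{(-1)^{i+1} b_i}
   = ∑_{n≥0} t^n ∑_{α∈P(n)} z^{2(n-|α|)} ∏_i M_{a_i}(z)`,
the infinite product converging in the t-adic topology: every coefficient of the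
partial products `∏_{k=1}^M` eventually (in `M`) equals the corresponding coefficient
of the right-hand side. -/
theorem goettsche_product_formula (b0 b1 b2 b3 b4 : ℕ) :
    ∀ n : ℕ, ∃ N : ℕ, ∀ M : ℕ, N ≤ M →
      PowerSeries.coeff (R := Polynomial ℤ) n
          (∏ k ∈ Finset.Icc 1 M, goettscheFactor b0 b1 b2 b3 b4 k) =
        PowerSeries.coeff (R := Polynomial ℤ) n (goettscheRHS b0 b1 b2 b3 b4) := by
  intro n
  obtain ⟨N, hN⟩ := coeff_prod_expand_rescale_eventually (fun i ↦ Polynomial.X ^ (2 * i - 2))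
    (macdonaldSeries b0 b1 b2 b3 b4) (constantCoeff_macdonaldSeries b0 b1 b2 b3 b4) n
  refine ⟨N, fun M hM ↦ ?_⟩
  rw [goettscheRHS_eq_genFun, ← hN M hM, Finset.range_eq_Ico,
    ← Finset.Ico_add_one_right_eq_Icc, ← Finset.prod_Ico_add' _ 0 M 1]
  simp only [goettscheFactor_eq _ _ _ _ _ (Nat.succ_ne_zero _)]
end

section
/- Let X be a finite set with |X| = e. For every n ≥ 0, the orbifold Euler number (1/n!) · ∑_{(σ,τ)∈G_n×G_n, στ=τσ} |(X^n)^σ ∩ (X^n)^τ| (where G_n acts on X^n by permuting coordinates) equals the coefficient of t^n in the formal power series ∏_{k≥1}(1-t^k)^{-e} ∈ ℚ[[t]]. -/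
/- STATEMENT 5: For a finite set `X` with `|X| = e` and `n ≥ 0`, the orbifold Euler
number `(1/n!)·∑_{στ=τσ} |(X^n)^σ ∩ (X^n)^τ|` of the symmetric group `G_n` acting on
`X^n` by permuting coordinates (`arrowAction`: `(σ • x) i = x (σ⁻¹ i)`) equals the
coefficient of `t^n` in `∏_{k≥1}(1-t^k)^{-e} ∈ ℚ[[t]]`, i.e. the eventual value of the
`t^n`-coefficient of the partial products `∏_{k=1}^M (1-t^k)^{-e}`, which converge in
the t-adic topology. -/

attribute [local instance] arrowAction

/-- Conjugacy classes of permutations are counted by partitions. -/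
theorem card_conjClasses_perm (α : Type*) [Fintype α] :
    Nat.card (ConjClasses (Equiv.Perm α)) = Fintype.card (Fintype.card α).Partition := by
  classical
  rw [← Nat.card_eq_fintype_card]
  refine Nat.card_eq_of_bijective
    (Quotient.lift (s := IsConj.setoid (Equiv.Perm α)) Equiv.Perm.partition
      fun _ _ h => Equiv.Perm.partition_eq_of_isConj.1 h) ⟨?_, ?_⟩
  · rintro ⟨σ⟩ ⟨τ⟩ h
    exact Quotient.sound (Equiv.Perm.partition_eq_of_isConj.2 h)
  · intro p
    have hsum : (p.parts.filter (2 ≤ ·)).sum + (p.parts.filter fun n => ¬ 2 ≤ n).sum =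
        Fintype.card α := by
      rw [← Multiset.sum_add, Multiset.filter_add_not, p.parts_sum]
    have hone : p.parts.filter (fun n => ¬ 2 ≤ n) =
        Multiset.replicate (p.parts.filter fun n => ¬ 2 ≤ n).card 1 := by
      rw [Multiset.eq_replicate_card]
      intro b hb
      have := p.parts_pos (Multiset.mem_filter.1 hb).1
      have := (Multiset.mem_filter.1 hb).2
      omega
    obtain ⟨σ, hσ⟩ := (Equiv.Perm.exists_with_cycleType_iff α
      (m := p.parts.filter (2 ≤ ·))).2 ⟨by omega, fun a ha => (Multiset.mem_filter.1 ha).2⟩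
    refine ⟨⟦σ⟧, Nat.Partition.ext ?_⟩
    change σ.partition.parts = p.parts
    rw [Equiv.Perm.parts_partition, ← Equiv.Perm.sum_cycleType, hσ]
    conv_rhs => rw [← Multiset.filter_add_not (2 ≤ ·) p.parts]
    congr 1
    rw [hone] at hsum ⊢
    rw [Multiset.sum_replicate, smul_eq_mul, mul_one] at hsum
    congr 1
    omega

/-- The number of commuting pairs of permutations of `m` points is `p(m) * m!`. -/
theorem card_commute_perm (α : Type*) [Fintype α] :
    Nat.card {p : Equiv.Perm α × Equiv.Perm α // Commute p.1 p.2} =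
      Fintype.card (Fintype.card α).Partition * (Fintype.card α).factorial := by
  rw [card_comm_eq_card_conjClasses_mul_card, card_conjClasses_perm, Nat.card_perm,
    Nat.card_eq_fintype_card]

/-- Commuting pairs in a product are families of commuting pairs in the factors. -/
theorem card_commute_pi {ι : Type*} [Fintype ι] (G : ι → Type*) [∀ i, Mul (G i)] :
    Nat.card {p : (∀ i, G i) × (∀ i, G i) // Commute p.1 p.2} =
      ∏ i, Nat.card {p : G i × G i // Commute p.1 p.2} := by
  simp_rw [← Nat.card_pi, Commute, SemiconjBy, funext_iff]
  exact Nat.card_congr ⟨fun x a => ⟨⟨x.1.1 a, x.1.2 a⟩, x.2 a⟩,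
    fun x => ⟨⟨fun a => (x a).1.1, fun a => (x a).1.2⟩, fun a => (x a).2⟩,
    fun _ => rfl, fun _ => rfl⟩

theorem mem_fixedBy_arrow_iff {α ι : Type*} (x : α → ι) (σ : Equiv.Perm α) :
    x ∈ MulAction.fixedBy (α → ι) σ ↔ x ∘ σ = x := by
  rw [MulAction.mem_fixedBy]
  change (fun a => x (σ⁻¹ a)) = x ↔ _
  simp only [funext_iff, Function.comp_apply]
  exact ⟨fun h a => by simpa using (h (σ a)).symm, fun h a => by simpa using (h (σ⁻¹ a)).symm⟩

/-- The stabilizer of a function is the product of the symmetric groups of its fibers. -/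
def stabilizerArrowMulEquiv {α ι : Type*} (x : α → ι) :
    MulAction.stabilizer (Equiv.Perm α) x ≃* ∀ i, Equiv.Perm {a // x a = i} where
  toEquiv := ((DomMulAct.mk.subtypeEquiv fun σ =>
      (mem_fixedBy_arrow_iff x σ).trans DomMulAct.mem_stabilizer_iff.symm).trans
        MulOpposite.opEquiv).trans (DomMulAct.stabilizerMulEquiv x).toEquiv
  map_mul' _ _ := rfl

/-- The number of commuting pairs of permutations fixing a given function. -/
theorem card_commute_stabilizer {α ι : Type*} [Fintype α] [Fintype ι] [DecidableEq ι]
    (x : α → ι) :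
    Nat.card {p : Equiv.Perm α × Equiv.Perm α // Commute p.1 p.2 ∧
        x ∈ MulAction.fixedBy (α → ι) p.1 ∩ MulAction.fixedBy (α → ι) p.2} =
      ∏ i, (Fintype.card (Fintype.card {a // x a = i}).Partition *
        (Fintype.card {a // x a = i}).factorial) := by
  classical
  let E := stabilizerArrowMulEquiv x
  simp_rw [← card_commute_perm, ← card_commute_pi]
  refine Nat.card_congr ⟨fun p => ⟨(E ⟨p.1.1, p.2.2.1⟩, E ⟨p.1.2, p.2.2.2⟩), ?_⟩,
    fun q => ⟨(E.symm q.1.1, E.symm q.1.2), ?_, (E.symm q.1.1).2, (E.symm q.1.2).2⟩, ?_, ?_⟩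
  · exact Commute.map (Subtype.ext p.2.1 : Commute
      (⟨p.1.1, p.2.2.1⟩ : MulAction.stabilizer (Equiv.Perm α) x) ⟨p.1.2, p.2.2.2⟩) E
  · exact (q.2.map E.symm).map (MulAction.stabilizer (Equiv.Perm α) x).subtype
  · intro p
    simp
  · intro q
    ext1
    exact Prod.ext (E.apply_symm_apply _) (E.apply_symm_apply _)

/-- A sum over functions that depends only on fiber sizes, grouped by fiber sizes. -/
theorem sum_fiber_card {R ι : Type*} [CommSemiring R] [Fintype ι] [DecidableEq ι] (n : ℕ)
    (h : (ι →₀ ℕ) → R) :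
    ∑ x : Fin n → ι, h (Finsupp.equivFunOnFinite.symm fun i => Fintype.card {a // x a = i}) =
      ∑ k ∈ Finset.piAntidiag Finset.univ n,
        (Nat.multinomial Finset.univ k : R) * h (Finsupp.equivFunOnFinite.symm k) := by
  let L : MvPolynomial ι R →ₗ[R] R := (MvPolynomial.basisMonomials ι R).constr R h
  have hL (k : ι →₀ ℕ) : L (∏ i, MvPolynomial.X i ^ k i) = h k := by
    have : (∏ i, MvPolynomial.X i ^ k i : MvPolynomial ι R) =
        MvPolynomial.basisMonomials ι R k := by
      simp [MvPolynomial.monomial_eq, Finsupp.prod_fintype]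
    rw [this, Module.Basis.constr_basis]
  have key := congrArg L ((Fintype.sum_pow (MvPolynomial.X : ι → MvPolynomial ι R) n).symm.trans
    (Finset.sum_pow_eq_sum_piAntidiag _ _ n))
  simp only [map_sum] at key
  convert! key using 2 with x _ k _
  · rw [← hL, ← Finset.prod_fiberwise_of_maps_to (g := x) (t := Finset.univ) (by simp)]
    congr 1
    refine Finset.prod_congr rfl fun i _ => ?_
    rw [Finset.prod_congr rfl fun a ha => by rw [(Finset.mem_filter.1 ha).2], Finset.prod_const,
      ← Fintype.card_subtype]
    rfl
  · rw [← nsmul_eq_mul, ← nsmul_eq_mul, map_nsmul, ← hL]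
    rfl

/-- The coefficients of a power of a power series, with factors indexed by a finite type. -/
theorem coeff_pow_card {R ι : Type*} [CommSemiring R] [Fintype ι] [DecidableEq ι]
    (P : PowerSeries R) (n : ℕ) :
    PowerSeries.coeff n (P ^ Fintype.card ι) =
      ∑ k ∈ Finset.piAntidiag (Finset.univ : Finset ι) n, ∏ i, PowerSeries.coeff (k i) P := by
  rw [← Finset.card_univ, ← Finset.prod_const, PowerSeries.coeff_prod]
  refine Finset.sum_equiv Finsupp.equivFunOnFinite (fun k => ?_) fun k _ => rfl
  simp [Finset.mem_finsuppAntidiag]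

open PowerSeries.WithPiTopology in
/-- Euler's product formula for the generating function of the partition numbers. -/
theorem hasProd_card_partition [TopologicalSpace ℚ] [T2Space ℚ] [IsTopologicalRing ℚ] :
    HasProd (fun i => (1 - (PowerSeries.X : PowerSeries ℚ) ^ (i + 1))⁻¹)
      (PowerSeries.mk fun m => (Fintype.card m.Partition : ℚ)) := by
  convert! Nat.Partition.hasProd_powerSeriesMk_card_restricted ℚ (fun _ => True) using 1
  · ext1 i
    rw [if_pos trivial, eq_comm, PowerSeries.eq_inv_iff_mul_eq_one (by simp)]
    simp_rw [pow_mul]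
    exact tsum_pow_mul_one_sub_of_constantCoeff_eq_zero (by simp)
  · simp [Nat.Partition.restricted]

open scoped PowerSeries.WithPiTopology in
theorem exists_forall_coeff_prod_eq (e n : ℕ) :
    ∃ N : ℕ, ∀ M : ℕ, N ≤ M →
      PowerSeries.coeff n ((PowerSeries.mk fun m => (Fintype.card m.Partition : ℚ)) ^ e) =
        PowerSeries.coeff n
          (∏ k ∈ Finset.Icc 1 M, ((1 - (PowerSeries.X : PowerSeries ℚ) ^ k)⁻¹) ^ e) := by
  let : TopologicalSpace ℚ := ⊥
  have : DiscreteTopology ℚ := ⟨rfl⟩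
  have hP := ((hasProd_card_partition.tendsto_prod_nat).pow e)
  have hc := ((PowerSeries.WithPiTopology.continuous_coeff ℚ n).tendsto _).comp hP
  rw [nhds_discrete, Filter.tendsto_pure] at hc
  obtain ⟨N, hN⟩ := Filter.eventually_atTop.1 hc
  refine ⟨N, fun M hM => ?_⟩
  rw [← hN M hM, Function.comp_apply, Finset.prod_pow, Finset.range_eq_Ico,
    Finset.prod_Ico_add' (fun k => (1 - (PowerSeries.X : PowerSeries ℚ) ^ k)⁻¹)]
  rfl

/-- The orbifold Euler number of `X ^ n` is the coefficient of `t ^ n` in the `|X|`-th power of the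
generating function of the partition numbers. -/
theorem sum_card_fixedBy_eq_coeff (X : Type*) [Fintype X] (n : ℕ) :
    (1 / (Nat.factorial n : ℚ)) *
        ∑ p : Equiv.Perm (Fin n) × Equiv.Perm (Fin n),
          (if p.1 * p.2 = p.2 * p.1 then
            ((MulAction.fixedBy (Fin n → X) p.1 ∩
                MulAction.fixedBy (Fin n → X) p.2).ncard : ℚ)
          else 0) =
      PowerSeries.coeff n
        ((PowerSeries.mk fun m => (Fintype.card m.Partition : ℚ)) ^ Fintype.card X) := by
  classical
  have hswap : ∑ p : Equiv.Perm (Fin n) × Equiv.Perm (Fin n),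
      (if p.1 * p.2 = p.2 * p.1 then
        ((MulAction.fixedBy (Fin n → X) p.1 ∩
            MulAction.fixedBy (Fin n → X) p.2).ncard : ℚ) else 0) =
      ∑ x : Fin n → X, (Nat.card {p : Equiv.Perm (Fin n) × Equiv.Perm (Fin n) //
        Commute p.1 p.2 ∧ x ∈ MulAction.fixedBy (Fin n → X) p.1 ∩
          MulAction.fixedBy (Fin n → X) p.2} : ℚ) := by
    simp_rw [Nat.card_eq_fintype_card, Fintype.card_subtype, Finset.card_filter, Nat.cast_sum]
    rw [Finset.sum_comm]
    refine Finset.sum_congr rfl fun p _ => ?_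
    by_cases hp : p.1 * p.2 = p.2 * p.1
    · have hp' : Commute p.1 p.2 := hp
      rw [if_pos hp, Set.ncard_eq_toFinset_card', Set.toFinset_card, Fintype.card_subtype,
        Finset.card_filter, Nat.cast_sum]
      simp only [hp', true_and]
    · have hp' : ¬ Commute p.1 p.2 := hp
      simp [hp, hp']
  simp_rw [hswap, card_commute_stabilizer]
  have hsum := sum_fiber_card (ι := X) n fun k =>
    ((∏ i, (Fintype.card (k i).Partition * (k i).factorial) : ℕ) : ℚ)
  simp only [Finsupp.equivFunOnFinite_symm_apply_apply] at hsum
  rw [hsum, coeff_pow_card, Finset.mul_sum]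
  refine Finset.sum_congr rfl fun k hk => ?_
  have hn : (n.factorial : ℚ) ≠ 0 := by positivity
  have hspec := Nat.multinomial_spec Finset.univ k
  rw [(Finset.mem_piAntidiag.1 hk).1] at hspec
  rw [one_div, inv_mul_eq_iff_eq_mul₀ hn, ← hspec, Finset.prod_mul_distrib]
  simp only [PowerSeries.coeff_mk]
  push_cast
  ring

theorem orbifold_euler_number_of_symmetric_product
    (X : Type*) [Fintype X] (e : ℕ) (he : Nat.card X = e) (n : ℕ) :
    ∃ N : ℕ, ∀ M : ℕ, N ≤ M →
      (1 / (Nat.factorial n : ℚ)) *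
          ∑ p : Equiv.Perm (Fin n) × Equiv.Perm (Fin n),
            (if p.1 * p.2 = p.2 * p.1 then
              ((MulAction.fixedBy (Fin n → X) p.1 ∩
                  MulAction.fixedBy (Fin n → X) p.2).ncard : ℚ)
            else 0) =
        PowerSeries.coeff (R := ℚ) n
          (∏ k ∈ Finset.Icc 1 M, ((1 - (PowerSeries.X : PowerSeries ℚ) ^ k)⁻¹) ^ e) := by
  subst he
  obtain ⟨N, hN⟩ := exists_forall_coeff_prod_eq (Nat.card X) n
  refine ⟨N, fun M hM => ?_⟩
  rw [← hN M hM, sum_card_fixedBy_eq_coeff, Nat.card_eq_fintype_card]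
end
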